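/- Theorem 5 (deterministic core: balanced loads give near-optimal delay). Suppose d_s ≥ Λ for every time slot s, and let β ≥ 1 be a real number. If the association g satisfies v_{s,λ} ≤ β · d_s/Λ for every slot s ∈ {1,…,S} and every cache λ ∈ {1,…,Λ}, then T̄(g) ≤ β · (1/S) Σ_{s=1}^{S} (d_s/Λ) · (Λ−t)/(1+t), and consequently T̄(g) ≤ 2β · T̄(g′) for every user-to-cache association g′; i.e., g is within a factor 2β of the optimal association. -/

import Mathlib

open Finset

noncomputable section

/-- Decreasing rearrangement of a tuple of naturals, indexed by `ℕ`
(value `0` out of range): `sortDescN v 0` is the largest entry. -/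
def sortDescN {Λ : ℕ} (v : Fin Λ → ℕ) (i : ℕ) : ℕ :=
  if h : i < Λ then (v ∘ Tuple.sort v) (Fin.rev ⟨i, h⟩) else 0

/-- Load of cache `c` at time slot `s` under activity matrix `D` and association `g`. -/
def loadD {S K Λ : ℕ} (D : Fin S → Fin K → Bool) (g : Fin K → Fin Λ)
    (s : Fin S) (c : Fin Λ) : ℕ :=
  ∑ k, if g k = c ∧ D s k = true then 1 else 0

/-- Total number of active users at time slot `s`: `d_s = ∑_k d_{s,k}`. -/
def dTot {S K : ℕ} (D : Fin S → Fin K → Bool) (s : Fin S) : ℕ :=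
  ∑ k, if D s k = true then 1 else 0

/-- Average delay in the data-driven setting:
`T̄(g) = (1/S) ∑_{s=1}^S ∑_{λ=1}^{Λ-t} l_{s,λ} C(Λ-λ,t)/C(Λ,t)`. -/
def avgDelayD {S K Λ : ℕ} (D : Fin S → Fin K → Bool) (g : Fin K → Fin Λ) (t : ℕ) : ℝ :=
  (1 / (S : ℝ)) *
    ∑ s : Fin S, ∑ i ∈ Finset.range (Λ - t),
      (sortDescN (loadD D g s) i : ℝ) * ((Λ - 1 - i).choose t : ℝ) / (Λ.choose t : ℝ)

lemma sortDescN_antitone {Λ : ℕ} (v : Fin Λ → ℕ) : Antitone (sortDescN v) := by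
  intro i j hij
  unfold sortDescN
  by_cases hj : j < Λ
  · rw [dif_pos hj, dif_pos (hij.trans_lt hj)]
    exact Tuple.monotone_sort v (Fin.rev_le_rev.mpr hij)
  · simp [hj]

lemma sum_sortDescN {Λ : ℕ} (v : Fin Λ → ℕ) :
    ∑ i ∈ range Λ, sortDescN v i = ∑ c, v c := by
  rw [Finset.sum_range, ← Equiv.sum_comp (Fin.revPerm.trans (Tuple.sort v)) v]
  exact Finset.sum_congr rfl fun i _ => by simp [sortDescN]

lemma sortDescN_le_of_forall_le {Λ : ℕ} {v : Fin Λ → ℕ} {B : ℝ} (hB : 0 ≤ B)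
    (hv : ∀ c, (v c : ℝ) ≤ B) (i : ℕ) : (sortDescN v i : ℝ) ≤ B := by
  unfold sortDescN
  split_ifs
  · exact hv _
  · simpa using hB

lemma sum_loadD {S K Λ : ℕ} (D : Fin S → Fin K → Bool) (g : Fin K → Fin Λ) (s : Fin S) :
    ∑ c, loadD D g s c = dTot D s := by
  unfold loadD dTot
  rw [Finset.sum_comm]
  exact Finset.sum_congr rfl fun k _ => by by_cases h : D s k = true <;> simp [h]

lemma sum_range_choose_right (n t : ℕ) :
    ∑ i ∈ range n, i.choose t = n.choose (t + 1) := by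
  induction n with
  | zero => simp
  | succ n ih => rw [sum_range_succ, ih, Nat.choose_succ_succ, add_comm]

lemma sum_choose_div_choose {Λ t : ℕ} (ht : t ≤ Λ) :
    ∑ i ∈ range Λ, ((Λ - 1 - i).choose t : ℝ) / (Λ.choose t : ℝ) =
      ((Λ : ℝ) - t) / (1 + t) := by
  have hpos : (0 : ℝ) < Λ.choose t := by exact_mod_cast Nat.choose_pos ht
  rw [← Finset.sum_div, Finset.sum_range_reflect (fun i => (i.choose t : ℝ)) Λ,
    ← Nat.cast_sum, sum_range_choose_right, div_eq_div_iff hpos.ne' (by positivity)]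
  have h := congrArg (Nat.cast (R := ℝ)) (Nat.choose_succ_right_eq Λ t)
  push_cast [Nat.cast_sub ht] at h
  linarith

/-- The delay of one slot may be summed over all caches, the extra weights being zero. -/
lemma sum_range_sub_delay {Λ t : ℕ} (f : ℕ → ℝ) :
    ∑ i ∈ range (Λ - t), f i * ((Λ - 1 - i).choose t : ℝ) / (Λ.choose t : ℝ) =
      ∑ i ∈ range Λ, f i * (((Λ - 1 - i).choose t : ℝ) / (Λ.choose t : ℝ)) := by
  simp only [mul_div_assoc]
  refine Finset.sum_subset (range_subset_range.mpr (Nat.sub_le _ _)) fun i hiΛ hi => ?_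
  rw [mem_range] at hiΛ hi
  rw [Nat.choose_eq_zero_of_lt (by omega)]
  simp

lemma slotDelay_le {Λ t : ℕ} (ht : t ≤ Λ) {v : Fin Λ → ℕ} {B : ℝ}
    (hB : 0 ≤ B) (hv : ∀ c, (v c : ℝ) ≤ B) :
    ∑ i ∈ range (Λ - t),
        (sortDescN v i : ℝ) * ((Λ - 1 - i).choose t : ℝ) / (Λ.choose t : ℝ) ≤
      B * (((Λ : ℝ) - t) / (1 + t)) := by
  rw [sum_range_sub_delay fun i => (sortDescN v i : ℝ), ← sum_choose_div_choose ht,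
    Finset.mul_sum]
  exact Finset.sum_le_sum fun i _ =>
    mul_le_mul_of_nonneg_right (sortDescN_le_of_forall_le hB hv i) (by positivity)

lemma le_slotDelay {Λ t : ℕ} (hΛ : 0 < Λ) (ht : t ≤ Λ) (v : Fin Λ → ℕ) :
    ((∑ c, v c : ℕ) : ℝ) / Λ * (((Λ : ℝ) - t) / (1 + t)) ≤
      ∑ i ∈ range (Λ - t),
        (sortDescN v i : ℝ) * ((Λ - 1 - i).choose t : ℝ) / (Λ.choose t : ℝ) := by
  have hΛ' : (0 : ℝ) < Λ := by exact_mod_cast hΛ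
  have hf : Antitone fun i => (sortDescN v i : ℝ) := fun i j hij =>
    Nat.cast_le.mpr (sortDescN_antitone v hij)
  have hw : Antitone fun i => ((Λ - 1 - i).choose t : ℝ) / (Λ.choose t : ℝ) := fun i j hij => by
    have h : (Λ - 1 - j).choose t ≤ (Λ - 1 - i).choose t := Nat.choose_le_choose t (by omega)
    dsimp only
    gcongr
  have key := ((hf.monovary hw).monovaryOn (range Λ : Set ℕ)).sum_mul_sum_le_card_mul_sum
  rw [← Nat.cast_sum, sum_sortDescN, sum_choose_div_choose ht, card_range] at key
  rw [sum_range_sub_delay fun i => (sortDescN v i : ℝ), div_mul_eq_mul_div,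
    div_le_iff₀ hΛ']
  linarith

/-- Theorem 5 (deterministic core): if every slot has at least `Λ` requests and the
loads of `g` are `β`-balanced (`v_{s,λ} ≤ β d_s/Λ`), then
`T̄(g) ≤ β (1/S) ∑_s (d_s/Λ)(Λ-t)/(1+t)`, and consequently `g` is within a factor
`2β` of every (hence of the optimal) association. -/
theorem theorem5_balanced_near_optimal {S K Λ t : ℕ} (hΛ : 2 ≤ Λ) (ht1 : 1 ≤ t)
    (ht2 : t ≤ Λ - 1) (hS : 1 ≤ S) (D : Fin S → Fin K → Bool) (g : Fin K → Fin Λ)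
    (β : ℝ) (hβ : 1 ≤ β)
    (hd : ∀ s : Fin S, Λ ≤ dTot D s)
    (hbal : ∀ (s : Fin S) (c : Fin Λ),
      (loadD D g s c : ℝ) ≤ β * (dTot D s : ℝ) / (Λ : ℝ)) :
    avgDelayD D g t ≤
        β * ((1 / (S : ℝ)) *
          ∑ s : Fin S, ((dTot D s : ℝ) / (Λ : ℝ)) * (((Λ : ℝ) - t) / (1 + t))) ∧
      ∀ g' : Fin K → Fin Λ, avgDelayD D g t ≤ 2 * β * avgDelayD D g' t := by
  have ht : t ≤ Λ := by omega
  have hΛ' : (0 : ℝ) < Λ := by exact_mod_cast (by omega : 0 < Λ)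
  have hS' : (0 : ℝ) ≤ 1 / (S : ℝ) := by positivity
  have hupper : avgDelayD D g t ≤
      β * ((1 / (S : ℝ)) *
        ∑ s : Fin S, ((dTot D s : ℝ) / (Λ : ℝ)) * (((Λ : ℝ) - t) / (1 + t))) := by
    rw [mul_left_comm, Finset.mul_sum]
    refine mul_le_mul_of_nonneg_left (Finset.sum_le_sum fun s _ => ?_) hS'
    rw [← mul_assoc, ← mul_div_assoc β]
    exact slotDelay_le ht (by positivity) (hbal s)
  refine ⟨hupper, fun g' => ?_⟩
  have hlower : (1 / (S : ℝ)) *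
        ∑ s : Fin S, ((dTot D s : ℝ) / (Λ : ℝ)) * (((Λ : ℝ) - t) / (1 + t)) ≤
      avgDelayD D g' t := by
    refine mul_le_mul_of_nonneg_left (Finset.sum_le_sum fun s _ => ?_) hS'
    rw [← sum_loadD D g' s]
    exact le_slotDelay (by omega) ht (loadD D g' s)
  have hnonneg : 0 ≤ avgDelayD D g' t := by
    unfold avgDelayD
    positivity
  have hβ' : 0 ≤ β * avgDelayD D g' t := mul_nonneg (by linarith) hnonneg
  have h := mul_le_mul_of_nonneg_left hlower (by linarith : 0 ≤ β)
  linarith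

end
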